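/- (Relative entropy estimate, part (II), velocity–null-Lagrangian cross term.) Let ê : ℝ¹⁹×[0,∞) → ℝ (with ξ = (F,ζ,w) ∈ M₃(ℝ)×M₃(ℝ)×ℝ) be C³, uniformly convex (∇²_{(ξ,η)}ê ≥ c𝕀 for some c > 0), and satisfy the growth conditions (G1)–(G3) with exponents p ≥ 4, q ≥ 2, ρ > 1, ℓ > 1. Then for every M > 0 there is a constant C₄ > 0 such that for all (F,v,η) ∈ M₃(ℝ)×ℝ³×[0,∞), all (F̄,v̄,η̄) ∈ Γ_M, and all indices B ∈ {1,…,19}, α ∈ {1,2,3}: | Σ_i ( ∂Φ^B/∂F_{iα}(F) − ∂Φ^B/∂F_{iα}(F̄) ) (v_i − v̄_i) | ≤ C₄ · I(v,Φ(F),η | v̄,Φ(F̄),η̄). -/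

import Mathlib

open scoped BigOperators
noncomputable section

/-- 3×3 real matrices, modelled as `Fin 3 → Fin 3 → ℝ`. -/
abbrev Mat : Type := Fin 3 → Fin 3 → ℝ

/-- The Levi-Civita symbol on `{0,1,2}`. -/
def lc (i j k : Fin 3) : ℝ :=
  (((j : ℕ) : ℝ) - ((i : ℕ) : ℝ)) * (((k : ℕ) : ℝ) - ((i : ℕ) : ℝ)) *
    (((k : ℕ) : ℝ) - ((j : ℕ) : ℝ)) / 2

/-- The cofactor matrix `(cof F)_{iα} = (1/2) Σ ε_{ijk} ε_{αβγ} F_{jβ} F_{kγ}`. -/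
def cof (F : Mat) : Mat := fun i α =>
  (1 / 2) * ∑ j, ∑ k, ∑ β, ∑ γ, lc i j k * lc α β γ * F j β * F k γ

/-- The determinant `det F = (1/6) Σ ε_{ijk} ε_{αβγ} F_{iα} F_{jβ} F_{kγ}`. -/
def mdet (F : Mat) : ℝ :=
  (1 / 6) * ∑ i, ∑ j, ∑ k, ∑ α, ∑ β, ∑ γ, lc i j k * lc α β γ * F i α * F j β * F k γ

/-- Frobenius norm of a 3×3 matrix. -/
def frob (F : Mat) : ℝ := Real.sqrt (∑ i, ∑ j, F i j ^ 2)

/-- The extended state space `ξ = (F, ζ, w) ∈ M₃(ℝ) × M₃(ℝ) × ℝ ≅ ℝ¹⁹`. -/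
abbrev Xi : Type := Mat × Mat × ℝ

/-- Extended state together with the entropy: `(ξ, η) ∈ ℝ¹⁹ × ℝ`. -/
abbrev XE : Type := Xi × ℝ

/-- The natural domain `{η ≥ 0}` of the internal energy. -/
def Dom : Set XE := {x | 0 ≤ x.2}

/-- The null-Lagrangian vector `Φ(F) = (F, cof F, det F)`. -/
def Phi (F : Mat) : Xi := (F, cof F, mdet F)

/-- Directional derivative of `eh` at `x` in the pure-`ξ` direction `d`
(equivalently `Σ_B (∂eh/∂ξ^B)(x) d^B`), taken within the domain `{η ≥ 0}`. -/
def dXi (eh : XE → ℝ) (x : XE) (d : Xi) : ℝ :=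
  fderivWithin ℝ eh Dom x (d, 0)

/-- `θ̂ = ∂eh/∂η`, taken within the domain `{η ≥ 0}`. -/
def dEta (eh : XE → ℝ) (x : XE) : ℝ :=
  fderivWithin ℝ eh Dom x (0, 1)

/-- Matrix of partial derivatives `∂eh/∂F`. -/
def dFmat (eh : XE → ℝ) (x : XE) : Mat :=
  fun i j => dXi eh x (Pi.single i (Pi.single j 1), 0, 0)

/-- Matrix of partial derivatives `∂eh/∂ζ`. -/
def dZmat (eh : XE → ℝ) (x : XE) : Mat :=
  fun i j => dXi eh x (0, Pi.single i (Pi.single j 1), 0)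

/-- Partial derivative `∂eh/∂w`. -/
def dW (eh : XE → ℝ) (x : XE) : ℝ := dXi eh x (0, 0, 1)

/-- Second directional derivative of `eh` at `x`, in directions `u` (outer) and
`d` (inner), within the domain `{η ≥ 0}`. -/
def d2 (eh : XE → ℝ) (x : XE) (u d : XE) : ℝ :=
  fderivWithin ℝ (fun y => fderivWithin ℝ eh Dom y d) Dom x u

/-- The weight `|F|^p + |ζ|^q + |w|^ρ + |η|^ℓ` appearing in the growth conditions. -/
def bigN (p q ρ ℓ : ℝ) (x : XE) : ℝ :=
  frob x.1.1 ^ p + frob x.1.2.1 ^ q + |x.1.2.2| ^ ρ + |x.2| ^ ℓ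

/-- Uniform convexity `∇²_{(ξ,η)} eh ≥ c 𝕀` (as quadratic forms, with the Euclidean
norm on `ℝ¹⁹ × ℝ`). -/
def UnifConvex (eh : XE → ℝ) (c : ℝ) : Prop :=
  ∀ x ∈ Dom, ∀ d : XE,
    c * (frob d.1.1 ^ 2 + frob d.1.2.1 ^ 2 + d.1.2.2 ^ 2 + d.2 ^ 2) ≤ d2 eh x d d

/-- Growth condition (G1): `c N(ξ,η) - c ≤ eh(ξ,η) ≤ c N(ξ,η) + c`. -/
def GrowthG1 (eh : XE → ℝ) (c p q ρ ℓ : ℝ) : Prop :=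
  ∀ x ∈ Dom, c * bigN p q ρ ℓ x - c ≤ eh x ∧ eh x ≤ c * bigN p q ρ ℓ x + c

/-- Growth condition (G2): `∂_η eh / N → 0` as `N → ∞`. -/
def GrowthG2 (eh : XE → ℝ) (p q ρ ℓ : ℝ) : Prop :=
  ∀ ε > (0:ℝ), ∃ R : ℝ, ∀ x ∈ Dom, R ≤ bigN p q ρ ℓ x → |dEta eh x| ≤ ε * bigN p q ρ ℓ x

/-- Growth condition (G3):
`|∂_F eh|^{p/(p-1)} + |∂_ζ eh|^{p/(p-2)} + |∂_w eh|^{p/(p-3)} ≤ c N + c`. -/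
def GrowthG3 (eh : XE → ℝ) (c p q ρ ℓ : ℝ) : Prop :=
  ∀ x ∈ Dom,
    frob (dFmat eh x) ^ (p / (p-1)) + frob (dZmat eh x) ^ (p / (p-2))
      + |dW eh x| ^ (p / (p-3)) ≤ c * bigN p q ρ ℓ x + c

/-- The relative internal energy
`eh(ξ,η | ξ̄,η̄) = eh(ξ,η) − eh(ξ̄,η̄) − ∇_ξ eh(ξ̄,η̄)·(ξ−ξ̄) − ∂_η eh(ξ̄,η̄)(η−η̄)`. -/
def erel (eh : XE → ℝ) (x xb : XE) : ℝ :=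
  eh x - eh xb - dXi eh xb (x.1 - xb.1) - dEta eh xb * (x.2 - xb.2)

/-- The relative total energy `I(v,ξ,η | v̄,ξ̄,η̄) = ½|v−v̄|² + eh(ξ,η|ξ̄,η̄)`. -/
def relI (eh : XE → ℝ) (v vb : Fin 3 → ℝ) (x xb : XE) : ℝ :=
  (1/2) * (∑ i, (v i - vb i)^2) + erel eh x xb

/-- The compact set `Γ_M = {(F̄,v̄,η̄) : |F̄| ≤ M, |v̄| ≤ M, 0 ≤ η̄ ≤ M}`. -/
def Gam (M : ℝ) (Fb : Mat) (vb : Fin 3 → ℝ) (ηb : ℝ) : Prop :=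
  frob Fb ≤ M ∧ Real.sqrt (∑ i, (vb i)^2) ≤ M ∧ 0 ≤ ηb ∧ ηb ≤ M

/-- `|Φ(F) − Φ(F̄)|²` (squared Euclidean distance of the null-Lagrangian vectors). -/
def phidist (F Fb : Mat) : ℝ :=
  frob (F - Fb) ^ 2 + frob (cof F - cof Fb) ^ 2 + (mdet F - mdet Fb) ^ 2

theorem uniqueDiffOn_Dom : UniqueDiffOn ℝ Dom := by
  have h : Dom = (Set.univ : Set Xi) ×ˢ Set.Ici (0 : ℝ) := by
    ext x
    simp [Dom]
  rw [h]
  exact uniqueDiffOn_univ.prod (uniqueDiffOn_Ici 0)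

theorem convex_Dom : Convex ℝ Dom := by
  intro x hx y hy a b ha hb _
  simp only [Dom, Set.mem_ofPred_eq] at *
  simpa using add_nonneg (mul_nonneg ha hx) (mul_nonneg hb hy)

theorem frob_sq (F : Mat) : frob F ^ 2 = ∑ i, ∑ j, F i j ^ 2 :=
  Real.sq_sqrt (Finset.sum_nonneg fun _ _ => Finset.sum_nonneg fun _ _ => sq_nonneg _)

theorem abs_lc_le_one (i j k : Fin 3) : |lc i j k| ≤ 1 := by
  fin_cases i <;> fin_cases j <;> fin_cases k <;> norm_num [lc]

/-- Second-order Taylor inequality on `[0, 1]` for a function with second derivative at least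
`k`. -/
theorem add_deriv_add_half_le {k : ℝ} {f f' f'' : ℝ → ℝ}
    (hf : ∀ t ∈ Set.Icc (0 : ℝ) 1, HasDerivWithinAt f (f' t) (Set.Icc 0 1) t)
    (hf' : ∀ t ∈ Set.Icc (0 : ℝ) 1, HasDerivWithinAt f' (f'' t) (Set.Icc 0 1) t)
    (hk : ∀ t ∈ Set.Icc (0 : ℝ) 1, k ≤ f'' t) :
    f 0 + f' 0 + k / 2 ≤ f 1 := by
  have h0 : (0 : ℝ) ∈ Set.Icc (0 : ℝ) 1 := by simp
  have h1 : (1 : ℝ) ∈ Set.Icc (0 : ℝ) 1 := by simp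
  have hd' : ∀ t ∈ Set.Icc (0 : ℝ) 1,
      HasDerivWithinAt (fun t => f' t - k * t) (f'' t - k) (Set.Icc 0 1) t := fun t ht => by
    refine ((hf' t ht).sub ((hasDerivWithinAt_id t _).const_mul k)).congr_deriv ?_
    simp
  have hmono' : MonotoneOn (fun t => f' t - k * t) (Set.Icc 0 1) :=
    monotoneOn_of_hasDerivWithinAt_nonneg (convex_Icc 0 1)
      (fun t ht => (hd' t ht).continuousWithinAt)
      (fun t ht => (hd' t (interior_subset ht)).mono interior_subset)
      (fun t ht => sub_nonneg.2 (hk t (interior_subset ht)))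
  have hd : ∀ t ∈ Set.Icc (0 : ℝ) 1,
      HasDerivWithinAt (fun t => f t - f' 0 * t - k / 2 * t ^ 2) (f' t - f' 0 - k * t)
        (Set.Icc 0 1) t := fun t ht => by
    refine (((hf t ht).sub ((hasDerivWithinAt_id t _).const_mul (f' 0))).sub
      (((hasDerivWithinAt_id t _).pow 2).const_mul (k / 2))).congr_deriv ?_
    simp
    ring
  have hmono : MonotoneOn (fun t => f t - f' 0 * t - k / 2 * t ^ 2) (Set.Icc 0 1) :=
    monotoneOn_of_hasDerivWithinAt_nonneg (convex_Icc 0 1)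
      (fun t ht => (hd t ht).continuousWithinAt)
      (fun t ht => (hd t (interior_subset ht)).mono interior_subset)
      (fun t ht => by
        have := hmono' h0 (interior_subset ht) (interior_subset ht).1
        simp only [mul_zero, sub_zero] at this
        linarith)
  have := hmono h0 h1 zero_le_one
  norm_num at this
  linarith

/-- Uniform convexity bounds the relative energy below by the squared distance. -/
theorem UnifConvex.le_erel {c : ℝ} {eh : XE → ℝ} (hconv : UnifConvex eh c)
    (hC : ContDiffOn ℝ 2 eh Dom) {x xb : XE} (hx : x ∈ Dom) (hxb : xb ∈ Dom) :
    c / 2 * (frob (x.1.1 - xb.1.1) ^ 2 + frob (x.1.2.1 - xb.1.2.1) ^ 2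
      + (x.1.2.2 - xb.1.2.2) ^ 2 + (x.2 - xb.2) ^ 2) ≤ erel eh x xb := by
  set d : XE := x - xb with hd
  have hmem : ∀ t ∈ Set.Icc (0 : ℝ) 1, xb + t • d ∈ Dom := fun t ht =>
    convex_Dom.add_smul_sub_mem hxb hx ht
  have hline : ∀ t : ℝ, HasDerivWithinAt (fun t : ℝ => xb + t • d) d (Set.Icc 0 1) t := fun t => by
    simpa using ((hasDerivWithinAt_id t (Set.Icc (0 : ℝ) 1)).smul_const d).const_add xb
  have hD : DifferentiableOn ℝ eh Dom := hC.differentiableOn (by norm_num)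
  have hD' : DifferentiableOn ℝ (fun y => fderivWithin ℝ eh Dom y d) Dom :=
    ((hC.fderivWithin (m := 1) uniqueDiffOn_Dom (by norm_num)).differentiableOn
      (by norm_num)).clm_apply (differentiableOn_const d)
  have htaylor := add_deriv_add_half_le
    (fun t ht => (hD _ (hmem t ht)).hasFDerivWithinAt.comp_hasDerivWithinAt t (hline t) hmem)
    (fun t ht => (hD' _ (hmem t ht)).hasFDerivWithinAt.comp_hasDerivWithinAt t (hline t) hmem)
    (fun t ht => hconv _ (hmem t ht) d)
  have hlin : fderivWithin ℝ eh Dom xb d = dXi eh xb d.1 + dEta eh xb * d.2 := by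
    have hsplit : d = (d.1, 0) + d.2 • ((0, 1) : XE) := by ext <;> simp
    conv_lhs => rw [hsplit]
    rw [map_add, map_smul, dXi, dEta, smul_eq_mul, mul_comm]
  simp only [Function.comp_apply, zero_smul, add_zero, one_smul, hlin] at htaylor
  rw [show xb + d = x by simp [hd]] at htaylor
  simp only [hd, Prod.fst_sub, Prod.snd_sub] at htaylor
  rw [erel]
  linarith

theorem abs_sum_mul_le_half {ι : Type*} [Fintype ι] (a b : ι → ℝ) :
    |∑ i, a i * b i| ≤ (∑ i, a i ^ 2 + ∑ i, b i ^ 2) / 2 := by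
  rw [← Finset.sum_add_distrib, Finset.sum_div]
  refine (Finset.abs_sum_le_sum_abs _ _).trans (Finset.sum_le_sum fun i _ => ?_)
  rw [abs_mul, ← sq_abs (a i), ← sq_abs (b i)]
  linarith [two_mul_le_add_sq |a i| |b i|]

theorem sq_sum_lc_mul_lc_mul_le (i k α γ : Fin 3) (G : Mat) :
    (∑ j, ∑ β, lc i j k * lc α β γ * G j β) ^ 2 ≤ 9 * frob G ^ 2 := by
  rw [frob_sq, ← Fintype.sum_prod_type', ← Fintype.sum_prod_type']
  refine (Finset.sum_mul_sq_le_sq_mul_sq _ _ _).trans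
    (mul_le_mul_of_nonneg_right ?_ (Finset.sum_nonneg fun _ _ => sq_nonneg _))
  have h : ∀ z ∈ (Finset.univ : Finset (Fin 3 × Fin 3)),
      (lc i z.1 k * lc α z.2 γ) ^ 2 ≤ 1 := fun z _ => by
    rw [sq_le_one_iff_abs_le_one, abs_mul]
    exact mul_le_one₀ (abs_lc_le_one _ _ _) (abs_nonneg _) (abs_lc_le_one _ _ _)
  simpa using Finset.sum_le_card_nsmul _ _ _ h

/-- relative entropy estimate, part (II): velocity–null-Lagrangian
cross term.  Under uniform convexity and (G1)–(G3), for every `M > 0` there is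
`C₄ > 0` such that for all `(F,v,η)`, all `(F̄,v̄,η̄) ∈ Γ_M`, every component
`B ∈ {1,…,19}` of the null-Lagrangian vector (split into its `F`-, `cof`- and
`det`-blocks) and every `α`:
`|Σ_i (∂Φ^B/∂F_{iα}(F) − ∂Φ^B/∂F_{iα}(F̄))(v_i − v̄_i)| ≤ C₄ I(v,Φ(F),η|v̄,Φ(F̄),η̄)`. -/
theorem velocity_null_lagrangian_cross_bound
    (c cg p q ρ ℓ : ℝ) (eh : XE → ℝ)
    (hc : 0 < c) (hcg : 0 < cg)
    (hp : 4 ≤ p) (hq : 2 ≤ q) (hρ : 1 < ρ) (hℓ : 1 < ℓ)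
    (hC3 : ContDiffOn ℝ 3 eh Dom)
    (hconv : UnifConvex eh c)
    (hG1 : GrowthG1 eh cg p q ρ ℓ)
    (hG2 : GrowthG2 eh p q ρ ℓ)
    (hG3 : GrowthG3 eh cg p q ρ ℓ)
    :
    ∀ M > (0:ℝ), ∃ C₄ > (0:ℝ),
      ∀ (F Fb : Mat) (v vb : Fin 3 → ℝ) (η ηb : ℝ),
        0 ≤ η → Gam M Fb vb ηb →
        (∀ j β α : Fin 3,
          |∑ i, ((if j = i then (1:ℝ) else 0) * (if β = α then (1:ℝ) else 0)
              - (if j = i then (1:ℝ) else 0) * (if β = α then (1:ℝ) else 0))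
            * (v i - vb i)|
            ≤ C₄ * relI eh v vb (Phi F, η) (Phi Fb, ηb))
        ∧ (∀ k γ α : Fin 3,
          |∑ i, (∑ j, ∑ β, lc i j k * lc α β γ * (F j β - Fb j β)) * (v i - vb i)|
            ≤ C₄ * relI eh v vb (Phi F, η) (Phi Fb, ηb))
        ∧ (∀ α : Fin 3,
          |∑ i, (cof F i α - cof Fb i α) * (v i - vb i)|
            ≤ C₄ * relI eh v vb (Phi F, η) (Phi Fb, ηb)) := by
  intro M _
  refine ⟨1 + 27 / c, by positivity, fun F Fb v vb η ηb hη hΓ => ?_⟩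
  have hrel := hconv.le_erel (hC3.of_le (by norm_num)) (x := (Phi F, η)) (xb := (Phi Fb, ηb))
    hη hΓ.2.2.1
  simp only [Phi] at hrel
  have hV : 0 ≤ ∑ i, (v i - vb i) ^ 2 := Finset.sum_nonneg fun _ _ => sq_nonneg _
  have hrelI : (∑ i, (v i - vb i) ^ 2) / 2
      + c / 2 * (frob (F - Fb) ^ 2 + frob (cof F - cof Fb) ^ 2)
      ≤ relI eh v vb (Phi F, η) (Phi Fb, ηb) := by
    rw [relI, Phi, Phi]
    have : 0 ≤ c / 2 * ((mdet F - mdet Fb) ^ 2 + (η - ηb) ^ 2) := by positivity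
    linarith
  set S := frob (F - Fb) ^ 2 with hS
  set T := frob (cof F - cof Fb) ^ 2 with hT
  set V := ∑ i, (v i - vb i) ^ 2
  set I := relI eh v vb (Phi F, η) (Phi Fb, ηb)
  have hS0 : 0 ≤ S := sq_nonneg _
  have hT0 : 0 ≤ T := sq_nonneg _
  have hbound : (27 * (S + T) + V) / 2 ≤ (1 + 27 / c) * I := by
    have h1 : (1 + 27 / c) * (V / 2 + c / 2 * (S + T)) ≤ (1 + 27 / c) * I :=
      mul_le_mul_of_nonneg_left hrelI (by positivity)
    have h2 : (1 + 27 / c) * (V / 2 + c / 2 * (S + T))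
        = (27 * (S + T) + V) / 2 + (c / 2 * (S + T) + 27 / c * (V / 2)) := by
      field_simp
      ring
    have h3 : 0 ≤ c / 2 * (S + T) + 27 / c * (V / 2) := by positivity
    linarith
  refine ⟨fun j β α => ?_, fun k γ α => ?_, fun α => ?_⟩
  · simp only [sub_self, zero_mul, Finset.sum_const_zero, abs_zero]
    linarith
  · refine (abs_sum_mul_le_half _ _).trans (le_trans ?_ hbound)
    have h : ∑ i, (∑ j, ∑ β, lc i j k * lc α β γ * (F j β - Fb j β)) ^ 2 ≤ ∑ _i : Fin 3, 9 * S :=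
      Finset.sum_le_sum fun i _ => sq_sum_lc_mul_lc_mul_le i k α γ (F - Fb)
    simp only [Finset.sum_const, Finset.card_univ, Fintype.card_fin, nsmul_eq_mul,
      Nat.cast_ofNat] at h
    linarith
  · refine (abs_sum_mul_le_half _ _).trans (le_trans ?_ hbound)
    have h : ∑ i, (cof F i α - cof Fb i α) ^ 2 ≤ T := by
      rw [hT, frob_sq]
      exact Finset.sum_le_sum fun i _ =>
        Finset.single_le_sum (f := fun j => (cof F - cof Fb) i j ^ 2)
          (fun _ _ => sq_nonneg _) (Finset.mem_univ α)
    linarith
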